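/- Let g : ℝ → ℝ be even and π-periodic, let m, n be positive integers, p = gcd(m, n), r = n/p, and μ = π/n. Define h(x) = ∏_{j=0}^{r−1} g(x + j·m·μ). Then h is an even function: h(−x) = h(x) for all x. -/

import Mathlib

open Real

theorem stmt_4 (g : ℝ → ℝ) (heven : ∀ x, g (-x) = g x) (hper : ∀ x, g (x + π) = g x)
    (m n : ℕ) (hm : 0 < m) (hn : 0 < n) :
    let p := Nat.gcd m n
    let r := n / p
    let μ := π / n
    let h : ℝ → ℝ := fun x => ∏ j ∈ Finset.range r, g (x + j * m * μ)
    ∀ x, h (-x) = h x := by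
  intro p r μ h x
  have hp : 0 < p := Nat.gcd_pos_of_pos_left _ hm
  obtain ⟨a, ha⟩ : p ∣ m := Nat.gcd_dvd_left m n
  have hr : p * r = n := Nat.mul_div_cancel' (Nat.gcd_dvd_right m n)
  have hr0 : r ≠ 0 := by
    intro h0
    rw [h0] at hr
    omega
  have hn' : (n : ℝ) ≠ 0 := by positivity
  have key : (r : ℝ) * m * μ = a * π := by
    have h1 : (r : ℝ) * m = a * n := by
      have : r * m = a * n := by rw [← hr, ha]; ring
      exact_mod_cast this
    rw [h1]
    simp only [μ]
    field_simp
  have hP : Function.Periodic g π := hper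
  have hPa : ∀ y, g (y + r * m * μ) = g y := by
    intro y
    rw [key]
    exact hP.nat_mul a y
  clear_value r μ
  obtain ⟨s, rfl⟩ := Nat.exists_eq_succ_of_ne_zero hr0
  have e1 : h (-x) = ∏ j ∈ Finset.range (s + 1), g (x + ((j + 1 : ℕ) : ℝ) * m * μ) := by
    simp only [h]
    rw [← Finset.prod_range_reflect]
    apply Finset.prod_congr rfl
    intro j hj
    have hj' : j ≤ s := by
      have := Finset.mem_range.mp hj
      omega
    have hc : ((s + 1 - 1 - j : ℕ) : ℝ) = s - j := by
      rw [Nat.add_sub_cancel, Nat.cast_sub hj']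
    rw [Nat.succ_eq_add_one, hc, ← heven, ← hPa]
    congr 1
    push_cast
    ring
  rw [e1, Finset.prod_range_succ]
  simp only [h]
  rw [Nat.succ_eq_add_one, Finset.prod_range_succ']
  congr 1
  rw [hPa]
  simp
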